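/- Let 𝒢 = (G_1,…,G_k) be a sunflower proper interval graph with shared graph S and simultaneous enumeration (σ_1,…,σ_k), and let C ⊆ G_i and C' ⊆ G_j be connected components that are both oriented at a block B of S. Then there exist two vertices u, v ∈ B such that B(u,C) <_{σ_i} B(v,C) and B(u,C') <_{σ_j} B(v,C'). -/

import Mathlib

/-!
Common definitions: graphs on a vertex subset, (proper/unit) interval
representations, blocks, straight enumerations, sunflower graphs,
simultaneous enumerations, components, chains/bars, etc.
-/

universe u

/-- A finite simple graph on a subset `verts` of an ambient vertex type `V`. -/
structure GraphOn (V : Type u) where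
  verts : Set V
  Adj : V → V → Prop
  symm : ∀ {u v}, Adj u v → Adj v u
  loopless : ∀ v, ¬ Adj v v
  mem_of_adj : ∀ {u v}, Adj u v → u ∈ verts ∧ v ∈ verts

namespace GraphOn

variable {V : Type u}

/-- The closed real interval assigned to vertex `v` by the endpoint map `I`. -/
def ivl (I : V → ℝ × ℝ) (v : V) : Set ℝ := Set.Icc (I v).1 (I v).2

/-- `I` is an interval representation of `G`: each vertex gets a (nonempty) closed
interval and intervals of distinct vertices intersect iff the vertices are adjacent. -/
def IsRep (G : GraphOn V) (I : V → ℝ × ℝ) : Prop :=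
  (∀ v ∈ G.verts, (I v).1 ≤ (I v).2) ∧
    ∀ u ∈ G.verts, ∀ v ∈ G.verts, u ≠ v → ((ivl I u ∩ ivl I v).Nonempty ↔ G.Adj u v)

/-- A proper interval representation: no interval properly contains another. -/
def IsProperRep (G : GraphOn V) (I : V → ℝ × ℝ) : Prop :=
  G.IsRep I ∧ ∀ u ∈ G.verts, ∀ v ∈ G.verts, u ≠ v → ¬ ivl I v ⊂ ivl I u

/-- A unit interval representation: all intervals have length one. -/
def IsUnitRep (G : GraphOn V) (I : V → ℝ × ℝ) : Prop :=
  G.IsRep I ∧ ∀ v ∈ G.verts, (I v).2 = (I v).1 + 1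

/-- Two vertices are in the same block iff they have equal closed neighborhoods. -/
def SameBlock (G : GraphOn V) (u v : V) : Prop :=
  u ∈ G.verts ∧ v ∈ G.verts ∧ ∀ w, (G.Adj u w ∨ u = w) ↔ (G.Adj v w ∨ v = w)

/-- Block-level closed adjacency: adjacent or in the same block. -/
def CAdj (G : GraphOn V) (u v : V) : Prop := G.Adj u v ∨ G.SameBlock u v

/-- `u` and `v` lie in the same connected component of `G` (and in `G`). -/
def Reach (G : GraphOn V) (u v : V) : Prop :=
  u ∈ G.verts ∧ v ∈ G.verts ∧ Relation.ReflTransGen G.Adj u v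

/-- The subgraph of `G` induced on the vertices of `G` lying in `C`. -/
def restrict (G : GraphOn V) (C : Set V) : GraphOn V where
  verts := G.verts ∩ C
  Adj u v := G.Adj u v ∧ u ∈ C ∧ v ∈ C
  symm h := ⟨G.symm h.1, h.2.2, h.2.1⟩
  loopless v h := G.loopless v h.1
  mem_of_adj h := ⟨⟨(G.mem_of_adj h.1).1, h.2.1⟩, (G.mem_of_adj h.1).2, h.2.2⟩

end GraphOn

open GraphOn

variable {V : Type u}

/-- The union graph `G_1 ∪ … ∪ G_k`. -/
def unionGraph {k : ℕ} (G : Fin k → GraphOn V) : GraphOn V where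
  verts := ⋃ i, (G i).verts
  Adj u v := ∃ i, (G i).Adj u v
  symm h := h.elim fun i hi => ⟨i, (G i).symm hi⟩
  loopless v h := h.elim fun i hi => (G i).loopless v hi
  mem_of_adj h := h.elim fun i hi =>
    ⟨Set.mem_iUnion.2 ⟨i, ((G i).mem_of_adj hi).1⟩,
     Set.mem_iUnion.2 ⟨i, ((G i).mem_of_adj hi).2⟩⟩

/-- A straight enumeration of `G`, encoded at the vertex level: `le u v` means the
block of `u` comes at or before the block of `v`.  It is a total preorder on the
vertices whose equivalence classes are exactly the blocks, and such that every block
together with its adjacent blocks is consecutive. -/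
structure StraightEnum {V : Type u} (G : GraphOn V) where
  le : V → V → Prop
  refl : ∀ v ∈ G.verts, le v v
  trans : ∀ u ∈ G.verts, ∀ v ∈ G.verts, ∀ w ∈ G.verts, le u v → le v w → le u w
  total : ∀ u ∈ G.verts, ∀ v ∈ G.verts, le u v ∨ le v u
  eq_block : ∀ u ∈ G.verts, ∀ v ∈ G.verts, (le u v ∧ le v u ↔ G.SameBlock u v)
  straight : ∀ u ∈ G.verts, ∀ v ∈ G.verts, ∀ w ∈ G.verts,
    le u v → le v w → G.CAdj u w → G.CAdj u v ∧ G.CAdj v w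

/-- `B(u,G) <_σ B(v,G)`: the block of `u` comes strictly before the block of `v`. -/
def StraightEnum.lt {V : Type u} {G : GraphOn V} (σ : StraightEnum G) (u v : V) : Prop :=
  σ.le u v ∧ ¬ σ.le v u

/-- `le` is a linear order on the set `s`. -/
def IsLinOrdOn (s : Set V) (le : V → V → Prop) : Prop :=
  (∀ v ∈ s, le v v) ∧ (∀ u ∈ s, ∀ v ∈ s, ∀ w ∈ s, le u v → le v w → le u w) ∧
    (∀ u ∈ s, ∀ v ∈ s, le u v → le v u → u = v) ∧ (∀ u ∈ s, ∀ v ∈ s, le u v ∨ le v u)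

/-- `le` is a partial order on the set `s`. -/
def IsPartialOrderOn (s : Set V) (le : V → V → Prop) : Prop :=
  (∀ v ∈ s, le v v) ∧ (∀ u ∈ s, ∀ v ∈ s, ∀ w ∈ s, le u v → le v w → le u w) ∧
    (∀ u ∈ s, ∀ v ∈ s, le u v → le v u → u = v)

/-- `S` is an induced subgraph of `G`. -/
def IsInduced (S G : GraphOn V) : Prop :=
  S.verts ⊆ G.verts ∧ ∀ u ∈ S.verts, ∀ v ∈ S.verts, (S.Adj u v ↔ G.Adj u v)

/-- `(G_1,…,G_k)` is a sunflower graph with shared graph `S`: any two distinct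
graphs share exactly `S` (vertices and edges), and `S` is induced in each `G_i`. -/
def IsSunflower {k : ℕ} (G : Fin k → GraphOn V) (S : GraphOn V) : Prop :=
  (∀ i, IsInduced S (G i)) ∧
    ∀ i j, i ≠ j → (G i).verts ∩ (G j).verts = S.verts ∧
      ∀ u v, (G i).Adj u v → (G j).Adj u v → S.Adj u v

/-- `𝒢` admits a simultaneous interval representation. -/
def HasSimRep {k : ℕ} (G : Fin k → GraphOn V) : Prop :=
  ∃ I : V → ℝ × ℝ, ∀ i, (G i).IsRep I

/-- `𝒢` admits a simultaneous proper interval representation. -/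
def HasSimProperRep {k : ℕ} (G : Fin k → GraphOn V) : Prop :=
  ∃ I : V → ℝ × ℝ, ∀ i, (G i).IsProperRep I

/-- `𝒢` admits a simultaneous unit interval representation. -/
def HasSimUnitRep {k : ℕ} (G : Fin k → GraphOn V) : Prop :=
  ∃ I : V → ℝ × ℝ, ∀ i, (G i).IsUnitRep I

/-- The representation `I` of `G` corresponds to (realizes) the straight enumeration `σ`:
ordering the intervals by left endpoints and grouping blocks yields `σ`. -/
def Realizes (G : GraphOn V) (I : V → ℝ × ℝ) (σ : StraightEnum G) : Prop :=
  ∀ u ∈ G.verts, ∀ v ∈ G.verts, σ.lt u v → (I u).1 < (I v).1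

/-- Simultaneous enumeration: blocks containing shared vertices are never ordered
oppositely in two of the straight enumerations. -/
def IsSimEnum {k : ℕ} (G : Fin k → GraphOn V) (S : GraphOn V)
    (σ : ∀ i, StraightEnum (G i)) : Prop :=
  ∀ i j, ∀ u ∈ S.verts, ∀ v ∈ S.verts, (σ i).lt u v → (σ j).le u v

/-- A straight enumeration `σ` of `G` is compatible with a linear order `ζ` of the
shared vertex set `VS`: `u ≤_ζ v` implies `B(u,G) ≤_σ B(v,G)`. -/
def Compatible (G : GraphOn V) (σ : StraightEnum G) (VS : Set V) (ζ : V → V → Prop) : Prop :=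
  ∀ u ∈ VS, ∀ v ∈ VS, ζ u v → σ.le u v

/-- The component of `c` in `G` is loose: all its shared vertices lie in one block of `S`. -/
def LooseAt (G S : GraphOn V) (c : V) : Prop :=
  c ∈ G.verts ∧ ∀ u v, G.Reach c u → G.Reach c v → u ∈ S.verts → v ∈ S.verts → S.SameBlock u v

/-- The component of `c` in `G` is oriented at the block of `b` in `S`: it aligns two
vertices of that block (they lie in different blocks of the component). -/
def OrientedAt (G S : GraphOn V) (c b : V) : Prop :=
  c ∈ G.verts ∧ b ∈ S.verts ∧ ∃ u v, G.Reach c u ∧ G.Reach c v ∧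
    S.SameBlock b u ∧ S.SameBlock b v ∧ ¬ G.SameBlock u v

/-- The component of `c` in `G` is independent: it aligns no two shared vertices. -/
def IndependentAt (G S : GraphOn V) (c : V) : Prop :=
  c ∈ G.verts ∧ ∀ u v, G.Reach c u → G.Reach c v → u ∈ S.verts → v ∈ S.verts → G.SameBlock u v

/-- `le'` is obtained from `le` by reversing exactly the components marked by `flip`
(componentwise-constant), keeping the order of the components themselves. -/
def ObtainedByFlip (G : GraphOn V) (flip : V → Prop) (le le' : V → V → Prop) : Prop :=
  (∀ u v, G.Reach u v → (flip u ↔ flip v)) ∧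
    ∀ u ∈ G.verts, ∀ v ∈ G.verts,
      (G.Reach u v → ((flip u → (le' u v ↔ le v u)) ∧ (¬ flip u → (le' u v ↔ le u v)))) ∧
      (¬ G.Reach u v → (le' u v ↔ le u v))

/-- `le'` is obtained from `le` through reversal of loose components. -/
def ObtainedByLooseReversals (G S : GraphOn V) (le le' : V → V → Prop) : Prop :=
  ∃ flip : V → Prop, (∀ c ∈ G.verts, flip c → LooseAt G S c) ∧
    ObtainedByFlip G flip le le'

/-- A family of flips (one per graph) corresponding to reversals of independent
components and of reversible parts: only loose components are flipped, and all
components oriented at a common block of `S` are flipped consistently and, if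
flipped, are all loose. -/
def ValidFlips {k : ℕ} (G : Fin k → GraphOn V) (S : GraphOn V)
    (flip : Fin k → V → Prop) : Prop :=
  (∀ i, ∀ c ∈ (G i).verts, flip i c → LooseAt (G i) S c) ∧
    ∀ b ∈ S.verts, ∀ i j c c', OrientedAt (G i) S c b → OrientedAt (G j) S c' b →
      (flip i c ↔ flip j c') ∧ (flip i c → LooseAt (G j) S c')

/-- `le` is a fine enumeration of the graph with vertex set `verts` and adjacency
`Adj`: a linear order on `verts` in which every closed neighborhood is consecutive. -/
def FineEnumOn (verts : Set V) (Adj : V → V → Prop) (le : V → V → Prop) : Prop :=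
  IsLinOrdOn verts le ∧
    ∀ u ∈ verts, ∀ a ∈ verts, ∀ b ∈ verts, ∀ c ∈ verts,
      le a b → le b c → (Adj u a ∨ u = a) → (Adj u c ∨ u = c) → (Adj u b ∨ u = b)

/-- A `(u,v)`-chain of size `l` in `(G,σ)`: a `σ`-increasing sequence from `u` to `v`
forming a path in `G`. -/
def IsChainSeq (G : GraphOn V) (σ : StraightEnum G) (u v : V) (l : ℕ) : Prop :=
  ∃ c : ℕ → V, c 0 = u ∧ c (l - 1) = v ∧ (∀ t < l, c t ∈ G.verts) ∧
    (∀ s t, s < t → t < l → σ.lt (c s) (c t)) ∧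
    (∀ t, t + 1 < l → G.Adj (c t) (c (t + 1)))

/-- A `(u,v)`-bar of size `l` in `(G,σ)`: a `σ`-increasing sequence from `u` to `v`
forming an independent set in `G`. -/
def IsBarSeq (G : GraphOn V) (σ : StraightEnum G) (u v : V) (l : ℕ) : Prop :=
  ∃ b : ℕ → V, b 0 = u ∧ b (l - 1) = v ∧ (∀ t < l, b t ∈ G.verts) ∧
    (∀ s t, s < t → t < l → σ.lt (b s) (b t)) ∧
    (∀ s t, s < l → t < l → s ≠ t → ¬ G.Adj (b s) (b t))

/-- `𝒢` has a (chain-bar-)conflict for the simultaneous enumeration `σ`. -/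
def HasConflict {k : ℕ} (G : Fin k → GraphOn V) (S : GraphOn V)
    (σ : ∀ i, StraightEnum (G i)) : Prop :=
  ∃ u ∈ S.verts, ∃ v ∈ S.verts, u ≠ v ∧ ∃ i j l, 2 ≤ l ∧
    IsChainSeq (G i) (σ i) u v l ∧ ∃ m, l ≤ m ∧ IsBarSeq (G j) (σ j) u v m

/-- The union of the block orders of the single enumerations. -/
def alphaStar {k : ℕ} (G : Fin k → GraphOn V) (σ : ∀ i, StraightEnum (G i))
    (u v : V) : Prop :=
  ∃ i, u ∈ (G i).verts ∧ v ∈ (G i).verts ∧ (σ i).le u v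

/-- The partial order `α` on `V(𝒢)` induced by the simultaneous enumeration:
the transitive closure of the union of the single block orders. -/
def alphaOrd {k : ℕ} (G : Fin k → GraphOn V) (σ : ∀ i, StraightEnum (G i)) :
    V → V → Prop :=
  Relation.TransGen (alphaStar G σ)

/-- The `α`-ordered pairs that are edges of some `G_i`. -/
def ERel {k : ℕ} (G : Fin k → GraphOn V) (σ : ∀ i, StraightEnum (G i))
    (u v : V) : Prop :=
  alphaOrd G σ u v ∧ ∃ i, (G i).Adj u v

/-- The `α`-ordered pairs that are non-edges of some `G_i` (both endpoints in `G_i`). -/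
def FRel {k : ℕ} (G : Fin k → GraphOn V) (σ : ∀ i, StraightEnum (G i))
    (u v : V) : Prop :=
  alphaOrd G σ u v ∧ u ≠ v ∧ ∃ i, u ∈ (G i).verts ∧ v ∈ (G i).verts ∧ ¬ (G i).Adj u v

/-- A partial order `τ` is left-closed: `(v,w) ∈ E`, `(u,x) ∈ F` and `x ≤_τ w`
imply `u <_τ v`. -/
def LeftClosed {k : ℕ} (G : Fin k → GraphOn V) (σ : ∀ i, StraightEnum (G i))
    (τ : V → V → Prop) : Prop :=
  ∀ v w u x, ERel G σ v w → FRel G σ u x → τ x w → τ u v ∧ u ≠ v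

/-- A relaxed `(u,v)`-chain of size `l`: an `α`-increasing sequence from `u` to `v`
forming a path in the union graph `G* = G_1 ∪ … ∪ G_k`. -/
def IsRelaxedChainSeq {k : ℕ} (G : Fin k → GraphOn V) (σ : ∀ i, StraightEnum (G i))
    (u v : V) (l : ℕ) : Prop :=
  ∃ c : ℕ → V, c 0 = u ∧ c (l - 1) = v ∧ (∀ t < l, c t ∈ ⋃ i, (G i).verts) ∧
    (∀ s t, s < t → t < l → alphaOrd G σ (c s) (c t) ∧ c s ≠ c t) ∧
    (∀ t, t + 1 < l → ∃ i, (G i).Adj (c t) (c (t + 1)))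

/-- `𝒢` has a relaxed conflict for the simultaneous enumeration `σ`. -/
def HasRelaxedConflict {k : ℕ} (G : Fin k → GraphOn V) (S : GraphOn V)
    (σ : ∀ i, StraightEnum (G i)) : Prop :=
  ∃ u ∈ S.verts, ∃ v ∈ S.verts, u ≠ v ∧ ∃ j l, 2 ≤ l ∧
    IsRelaxedChainSeq G σ u v l ∧ ∃ m, l ≤ m ∧ IsBarSeq (G j) (σ j) u v m

theorem GraphOn.SameBlock.symm {G : GraphOn V} {u v : V} (h : G.SameBlock u v) :
    G.SameBlock v u :=
  ⟨h.2.1, h.1, fun w => (h.2.2 w).symm⟩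

theorem GraphOn.SameBlock.trans {G : GraphOn V} {u v w : V} (huv : G.SameBlock u v)
    (hvw : G.SameBlock v w) : G.SameBlock u w :=
  ⟨huv.1, hvw.2.1, fun x => (huv.2.2 x).trans (hvw.2.2 x)⟩

theorem GraphOn.SameBlock.adj_or_eq {G : GraphOn V} {u v : V} (h : G.SameBlock u v) :
    G.Adj u v ∨ u = v :=
  (h.2.2 v).2 (Or.inr rfl)

/-- A component containing one vertex of a block of an induced subgraph contains the whole
block. -/
theorem GraphOn.Reach.of_sameBlock {G S : GraphOn V} (hS : IsInduced S G) {c u v : V}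
    (hcu : G.Reach c u) (h : S.SameBlock u v) : G.Reach c v := by
  refine ⟨hcu.1, hS.1 h.2.1, ?_⟩
  rcases h.adj_or_eq with hadj | rfl
  · exact hcu.2.2.tail ((hS.2 u h.1 v h.2.1).1 hadj)
  · exact hcu.2.2

/-- An enumeration strictly orders, one way or the other, two vertices in different blocks. -/
theorem StraightEnum.lt_or_lt {G : GraphOn V} (σ : StraightEnum G) {u v : V}
    (hu : u ∈ G.verts) (hv : v ∈ G.verts) (h : ¬ G.SameBlock u v) :
    σ.lt u v ∨ σ.lt v u := by
  have hblock := σ.eq_block u hu v hv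
  have htotal := σ.total u hu v hv
  unfold StraightEnum.lt
  tauto

/-- An oriented component contains the whole block at which it is oriented, and strictly orders
two of its vertices. -/
theorem OrientedAt.reach_and_exists_lt {G S : GraphOn V} (hS : IsInduced S G)
    (σ : StraightEnum G) {c b : V} (h : OrientedAt G S c b) :
    (∀ w, S.SameBlock b w → G.Reach c w) ∧
      ∃ u v, S.SameBlock b u ∧ S.SameBlock b v ∧ σ.lt u v := by
  obtain ⟨-, -, u, v, hcu, hcv, hbu, hbv, hne⟩ := h
  refine ⟨fun w hbw => hcu.of_sameBlock hS (hbu.symm.trans hbw), ?_⟩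
  rcases σ.lt_or_lt hcu.2.1 hcv.2.1 hne with hlt | hlt
  · exact ⟨u, v, hbu, hbv, hlt⟩
  · exact ⟨v, u, hbv, hbu, hlt⟩

/-- Let `r` and `r'` be total preorders on `s` that never order two elements oppositely. If each of
them strictly orders some pair, then some pair is strictly ordered by both. -/
theorem exists_common_lt {s : Set V} {r r' : V → V → Prop}
    (htrans : ∀ x ∈ s, ∀ y ∈ s, ∀ z ∈ s, r x y → r y z → r x z)
    (htotal : ∀ x ∈ s, ∀ y ∈ s, r x y ∨ r y x)
    (htrans' : ∀ x ∈ s, ∀ y ∈ s, ∀ z ∈ s, r' x y → r' y z → r' x z)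
    (hrr' : ∀ x ∈ s, ∀ y ∈ s, r x y ∧ ¬ r y x → r' x y)
    (hr'r : ∀ x ∈ s, ∀ y ∈ s, r' x y ∧ ¬ r' y x → r x y)
    {u v x y : V} (hu : u ∈ s) (hv : v ∈ s) (hx : x ∈ s) (hy : y ∈ s)
    (huv : r u v ∧ ¬ r v u) (hxy : r' x y ∧ ¬ r' y x) :
    ∃ p ∈ s, ∃ q ∈ s, (r p q ∧ ¬ r q p) ∧ (r' p q ∧ ¬ r' q p) := by
  have hxy' := hr'r x hx y hy hxy
  by_cases hxu : r x u
  · have hxv : r x v := htrans x hx u hu v hv hxu huv.1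
    have hvx : ¬ r v x := fun h => huv.2 (htrans v hv x hx u hu h hxu)
    by_cases hyx : r y x
    · have hyv : r' y v := hrr' y hy v hv
        ⟨htrans y hy x hx v hv hyx hxv, fun h => hvx (htrans v hv y hy x hx h hyx)⟩
      exact ⟨x, hx, v, hv, ⟨hxv, hvx⟩, htrans' x hx y hy v hv hxy.1 hyv,
        fun h => hxy.2 (htrans' y hy v hv x hx hyv h)⟩
    · exact ⟨x, hx, y, hy, ⟨hxy', hyx⟩, hxy⟩
  · have hux : r u x := (htotal u hu x hx).resolve_right hxu
    have hux' : r' u x := hrr' u hu x hx ⟨hux, hxu⟩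
    exact ⟨u, hu, y, hy,
      ⟨htrans u hu x hx y hy hux hxy', fun h => hxu (htrans x hx y hy u hu hxy' h)⟩,
      htrans' u hu x hx y hy hux' hxy.1, fun h => hxy.2 (htrans' y hy u hu x hx h hux')⟩

/-- If two components `C ⊆ G_i` and `C' ⊆ G_j` are both oriented at a
block `B` of the shared graph `S` (block of the vertex `b`), then there are two
vertices `u, v ∈ B` with `B(u,C) <_{σ_i} B(v,C)` and `B(u,C') <_{σ_j} B(v,C')`. -/
theorem oriented_components_dependent {V : Type u} [Fintype V] {k : ℕ}
    (G : Fin k → GraphOn V) (S : GraphOn V) (hsun : IsSunflower G S)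
    (hrep : HasSimProperRep G)
    (σ : ∀ i, StraightEnum (G i)) (hσ : IsSimEnum G S σ)
    (i j : Fin k) (c c' b : V)
    (hC : OrientedAt (G i) S c b) (hC' : OrientedAt (G j) S c' b) :
    ∃ u v, S.SameBlock b u ∧ S.SameBlock b v ∧
      (G i).Reach c u ∧ (G i).Reach c v ∧ (G j).Reach c' u ∧ (G j).Reach c' v ∧
      (σ i).lt u v ∧ (σ j).lt u v := by
  obtain ⟨hreach, u, v, hu, hv, huv⟩ := hC.reach_and_exists_lt (hsun.1 i) (σ i)
  obtain ⟨hreach', x, y, hx, hy, hxy⟩ := hC'.reach_and_exists_lt (hsun.1 j) (σ j)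
  have hmem : ∀ w, S.SameBlock b w → w ∈ (G i).verts := fun w hw => (hreach w hw).2.1
  have hmem' : ∀ w, S.SameBlock b w → w ∈ (G j).verts := fun w hw => (hreach' w hw).2.1
  obtain ⟨p, hp, q, hq, hpq, hpq'⟩ := exists_common_lt (s := {w | S.SameBlock b w})
    (fun x hx y hy z hz => (σ i).trans x (hmem x hx) y (hmem y hy) z (hmem z hz))
    (fun x hx y hy => (σ i).total x (hmem x hx) y (hmem y hy))
    (fun x hx y hy z hz => (σ j).trans x (hmem' x hx) y (hmem' y hy) z (hmem' z hz))
    (fun x hx y hy => hσ i j x hx.2.1 y hy.2.1)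
    (fun x hx y hy => hσ j i x hx.2.1 y hy.2.1) hu hv hx hy huv hxy
  exact ⟨p, q, hp, hq, hreach p hp, hreach q hq, hreach' p hp, hreach' q hq, hpq, hpq'⟩
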